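/- arXiv:2512.20593 — 2 statements merged into one kernel-verified Lean document; each statement's English description precedes it below -/
import Mathlib

section
/- Let q₁, q₂ be real numbers with 0 < q₁ ≤ q₂ < 1 and let a₁, a₂, x, b₁, b₂ be integers with a₁ ≤ a₂ ≤ x ≤ b₁ ≤ b₂. Then 0 ≤ G(x | a₁,b₁,q₁; a₂,b₂,q₂), i.e. 0 ≤ q₁^{a₁} q₂^{x+1} − q₁^{b₁+1} q₂^{x+1} + q₁^{b₁+1} q₂^{a₂} − q₁^{x+1} q₂^{a₂} − q₁^{a₁} q₂^{b₂+1} + q₁^{x+1} q₂^{b₂+1}. -/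
/-- Cross-multiplied monotonicity in `p` of `p ^ m * (1 - p ^ n) / (1 - p ^ m)`. -/
lemma pow_mul_one_sub_pow_mul_le {p q : ℝ} (hp : 0 < p) (hpq : p ≤ q) (hq : q < 1) (m n : ℕ) :
    p ^ m * (1 - p ^ n) * (1 - q ^ m) ≤ q ^ m * (1 - p ^ m) * (1 - q ^ n) := by
  have hq0 : 0 < q := hp.trans_le hpq
  have hm : p ^ m * ∑ i ∈ Finset.range m, q ^ i ≤ q ^ m * ∑ i ∈ Finset.range m, p ^ i := by
    rw [Finset.mul_sum, Finset.mul_sum]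
    refine Finset.sum_le_sum fun i hi => ?_
    obtain ⟨k, rfl⟩ := Nat.exists_eq_add_of_le (Finset.mem_range.mp hi).le
    have hk : p ^ k ≤ q ^ k := by gcongr
    calc p ^ (i + k) * q ^ i = p ^ i * q ^ i * p ^ k := by ring
      _ ≤ p ^ i * q ^ i * q ^ k := by gcongr
      _ = q ^ (i + k) * p ^ i := by ring
  have hn : ∑ i ∈ Finset.range n, p ^ i ≤ ∑ i ∈ Finset.range n, q ^ i := by
    gcongr
  have hp1 : 0 ≤ 1 - p := by linarith
  have hq1 : 0 ≤ 1 - q := by linarith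
  rw [← mul_neg_geom_sum p n, ← mul_neg_geom_sum q m, ← mul_neg_geom_sum p m,
    ← mul_neg_geom_sum q n]
  calc _ = (1 - p) * (1 - q) * ((p ^ m * ∑ i ∈ Finset.range m, q ^ i) *
          ∑ i ∈ Finset.range n, p ^ i) := by ring
    _ ≤ (1 - p) * (1 - q) * ((q ^ m * ∑ i ∈ Finset.range m, p ^ i) *
          ∑ i ∈ Finset.range n, q ^ i) := by gcongr
    _ = _ := by ring

/-- For 0 < q₁ ≤ q₂ < 1 and integers a₁ ≤ a₂ ≤ x ≤ b₁ ≤ b₂ one has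
0 ≤ G(x | a₁,b₁,q₁; a₂,b₂,q₂). -/
theorem statement0 (q₁ q₂ : ℝ) (hq₁ : 0 < q₁) (hq₁₂ : q₁ ≤ q₂) (hq₂ : q₂ < 1)
    (a₁ a₂ x b₁ b₂ : ℤ) (ha : a₁ ≤ a₂) (hax : a₂ ≤ x) (hxb : x ≤ b₁) (hb : b₁ ≤ b₂) :
    0 ≤ q₁ ^ a₁ * q₂ ^ (x + 1) - q₁ ^ (b₁ + 1) * q₂ ^ (x + 1) + q₁ ^ (b₁ + 1) * q₂ ^ a₂
        - q₁ ^ (x + 1) * q₂ ^ a₂ - q₁ ^ a₁ * q₂ ^ (b₂ + 1) + q₁ ^ (x + 1) * q₂ ^ (b₂ + 1) := by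
  have hq₂0 : 0 < q₂ := hq₁.trans_le hq₁₂
  have hq₁1 : q₁ < 1 := hq₁₂.trans_lt hq₂
  obtain ⟨m, hm⟩ := Int.eq_ofNat_of_zero_le (show 0 ≤ x + 1 - a₂ by lia)
  obtain ⟨n, hn⟩ := Int.eq_ofNat_of_zero_le (show 0 ≤ b₁ - x by lia)
  have split_x (q : ℝ) (hq : 0 < q) : q ^ (x + 1) = q ^ a₂ * q ^ m := by
    rw [show x + 1 = a₂ + m by lia, zpow_add₀ hq.ne', zpow_natCast]
  have split_b (q : ℝ) (hq : 0 < q) : q ^ (b₁ + 1) = q ^ (x + 1) * q ^ n := by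
    rw [show b₁ + 1 = x + 1 + n by lia, zpow_add₀ hq.ne', zpow_natCast]
  have hA : q₁ ^ a₂ ≤ q₁ ^ a₁ := zpow_le_zpow_right_of_le_one₀ hq₁ hq₁1.le ha
  have hB : q₂ ^ (b₂ + 1) ≤ q₂ ^ (b₁ + 1) :=
    zpow_le_zpow_right_of_le_one₀ hq₂0 hq₂.le (by lia)
  have hX : q₁ ^ (x + 1) ≤ q₁ ^ a₂ :=
    zpow_le_zpow_right_of_le_one₀ hq₁ hq₁1.le (by lia)
  have hY : q₂ ^ (b₁ + 1) ≤ q₂ ^ (x + 1) :=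
    zpow_le_zpow_right_of_le_one₀ hq₂0 hq₂.le (by lia)
  have hkey : (q₁ ^ (x + 1) - q₁ ^ (b₁ + 1)) * (q₂ ^ a₂ - q₂ ^ (x + 1)) ≤
      (q₁ ^ a₂ - q₁ ^ (x + 1)) * (q₂ ^ (x + 1) - q₂ ^ (b₁ + 1)) := by
    rw [split_b q₁ hq₁, split_b q₂ hq₂0, split_x q₁ hq₁, split_x q₂ hq₂0]
    have h := mul_le_mul_of_nonneg_left (pow_mul_one_sub_pow_mul_le hq₁ hq₁₂ hq₂ m n)
      (mul_pos (zpow_pos hq₁ a₂) (zpow_pos hq₂0 a₂)).le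
    linarith
  have hmono : (q₁ ^ a₂ - q₁ ^ (x + 1)) * (q₂ ^ (x + 1) - q₂ ^ (b₁ + 1)) ≤
      (q₁ ^ a₁ - q₁ ^ (x + 1)) * (q₂ ^ (x + 1) - q₂ ^ (b₂ + 1)) :=
    mul_le_mul (by linarith) (by linarith) (by linarith) (by linarith)
  linarith
end

section
/- Let q₁, q₂ ∈ (0,1) be reals and let a₁, a₂, x, b₁, b₂ be integers with a₁ ≤ a₂ ≤ x ≤ b₁ ≤ b₂. Then G(x | a₁,b₁,q₁; a₂,b₂,q₂) − G(x | a₂,b₁,q₁; a₂,b₁,q₂) = (q₁^{a₁} − q₁^{a₂})(q₂^{x+1} − q₂^{b₂+1}) + (q₂^{b₁+1} − q₂^{b₂+1})(q₁^{a₂} − q₁^{x+1}), and this quantity is nonnegative; in particular G(x | a₁,b₁,q₁; a₂,b₂,q₂) ≥ G(x | a₂,b₁,q₁; a₂,b₁,q₂). -/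
/-- The quantity G(x | a₁,b₁,q₁; a₂,b₂,q₂), with integer powers (zpow). -/
noncomputable def Gquant (q₁ q₂ : ℝ) (a₁ b₁ a₂ b₂ x : ℤ) : ℝ :=
  q₁ ^ a₁ * q₂ ^ (x + 1) - q₁ ^ (b₁ + 1) * q₂ ^ (x + 1) + q₁ ^ (b₁ + 1) * q₂ ^ a₂
    - q₁ ^ (x + 1) * q₂ ^ a₂ - q₁ ^ a₁ * q₂ ^ (b₂ + 1) + q₁ ^ (x + 1) * q₂ ^ (b₂ + 1)

/-- For q₁, q₂ ∈ (0,1) and integers a₁ ≤ a₂ ≤ x ≤ b₁ ≤ b₂,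
G(x | a₁,b₁,q₁; a₂,b₂,q₂) − G(x | a₂,b₁,q₁; a₂,b₁,q₂)
  = (q₁^{a₁} − q₁^{a₂})(q₂^{x+1} − q₂^{b₂+1}) + (q₂^{b₁+1} − q₂^{b₂+1})(q₁^{a₂} − q₁^{x+1}),
this quantity is nonnegative, and in particular
G(x | a₂,b₁,q₁; a₂,b₁,q₂) ≤ G(x | a₁,b₁,q₁; a₂,b₂,q₂). -/
theorem statement1 (q₁ q₂ : ℝ) (hq₁0 : 0 < q₁) (hq₁1 : q₁ < 1) (hq₂0 : 0 < q₂) (hq₂1 : q₂ < 1)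
    (a₁ a₂ x b₁ b₂ : ℤ) (ha : a₁ ≤ a₂) (hax : a₂ ≤ x) (hxb : x ≤ b₁) (hb : b₁ ≤ b₂) :
    Gquant q₁ q₂ a₁ b₁ a₂ b₂ x - Gquant q₁ q₂ a₂ b₁ a₂ b₁ x
        = (q₁ ^ a₁ - q₁ ^ a₂) * (q₂ ^ (x + 1) - q₂ ^ (b₂ + 1))
          + (q₂ ^ (b₁ + 1) - q₂ ^ (b₂ + 1)) * (q₁ ^ a₂ - q₁ ^ (x + 1)) ∧
      0 ≤ (q₁ ^ a₁ - q₁ ^ a₂) * (q₂ ^ (x + 1) - q₂ ^ (b₂ + 1))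
          + (q₂ ^ (b₁ + 1) - q₂ ^ (b₂ + 1)) * (q₁ ^ a₂ - q₁ ^ (x + 1)) ∧
      Gquant q₁ q₂ a₂ b₁ a₂ b₁ x ≤ Gquant q₁ q₂ a₁ b₁ a₂ b₂ x := by
  have key : Gquant q₁ q₂ a₁ b₁ a₂ b₂ x - Gquant q₁ q₂ a₂ b₁ a₂ b₁ x
      = (q₁ ^ a₁ - q₁ ^ a₂) * (q₂ ^ (x + 1) - q₂ ^ (b₂ + 1))
        + (q₂ ^ (b₁ + 1) - q₂ ^ (b₂ + 1)) * (q₁ ^ a₂ - q₁ ^ (x + 1)) := by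
    unfold Gquant
    ring
  have anti₁ {m n : ℤ} (h : m ≤ n) : 0 ≤ q₁ ^ m - q₁ ^ n :=
    sub_nonneg.2 (zpow_le_zpow_right_of_le_one₀ hq₁0 hq₁1.le h)
  have anti₂ {m n : ℤ} (h : m ≤ n) : 0 ≤ q₂ ^ m - q₂ ^ n :=
    sub_nonneg.2 (zpow_le_zpow_right_of_le_one₀ hq₂0 hq₂1.le h)
  have nonneg := add_nonneg
    (mul_nonneg (anti₁ ha) (anti₂ (show x + 1 ≤ b₂ + 1 by omega)))
    (mul_nonneg (anti₂ (show b₁ + 1 ≤ b₂ + 1 by omega)) (anti₁ (show a₂ ≤ x + 1 by omega)))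
  exact ⟨key, nonneg, sub_nonneg.1 (key ▸ nonneg)⟩
end
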